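/- (Total-minor Polynomial v2) Let G be an oriented hypergraph with incidence matrix H and Laplacian L = H·Hᵀ, and let X be the V×V matrix of indeterminates x_{v,w}. Then det(X − L) = Σ_{(U,φ)} ( Σ_{c} csgn(c) ) · Π_{u∈U} x_{u,φ(u)}, where the outer sum runs over all subsets U ⊆ V together with all injections φ: U → V, and the inner sum runs over only the edge-monic nonzero reduced [u,w]-contributors c of G for the injection φ. -/

import Mathlib

open Matrix
open scoped Classical

noncomputable section

/-- An oriented hypergraph `G = (V, E, I, ς, ω, σ)`: `vtx = ς` assigns each incidence
its vertex, `edg = ω` assigns each incidence its edge, and `sgn = σ` is its sign. -/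
structure OHG (V E I : Type*) where
  vtx : I → V
  edg : I → E
  sgn : I → ℤˣ

variable {V E I : Type*} [Fintype V] [DecidableEq V] [Fintype E] [DecidableEq E]
  [Fintype I] [DecidableEq I]

/-- A (nonzero) reduced `[u,w]`-contributor for the injection `φ : U → V` with image
`W`: a map `c : V∖U → I × I` whose tails sit at their vertices, whose tail and head
share an edge, and whose head map is a bijection from `V∖U` onto `V∖W`. -/
def IsRedCont (G : OHG V E I) (U : Finset V) (φ : {v : V // v ∈ U} ↪ V)
    (c : {v : V // v ∉ U} → I × I) : Prop :=
  (∀ v, G.vtx (c v).1 = v.1) ∧ (∀ v, G.edg (c v).1 = G.edg (c v).2) ∧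
    Set.BijOn (fun v : {v : V // v ∉ U} => G.vtx (c v).2) Set.univ
      {w : V | w ∉ Set.range φ}

/-- The completion `č` of a reduced contributor: the self-map of `V` agreeing with the
head map of `c` on `V∖U` and with `φ` on `U`. -/
def compFun (G : OHG V E I) (U : Finset V) (φ : {v : V // v ∈ U} ↪ V)
    (c : {v : V // v ∉ U} → I × I) : V → V :=
  fun v => if h : v ∈ U then φ ⟨v, h⟩ else G.vtx (c ⟨v, h⟩).2

/-- The orbit of `v` under iteration of `f` (for `f` a bijection of a finite type this
is the full cycle of `v`). -/
def orbitOf (f : V → V) (v : V) : Finset V :=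
  Finset.univ.filter fun w => ∃ n : ℕ, f^[n] v = w

/-- The set of orbits of `f`. -/
def orbitsOf (f : V → V) : Finset (Finset V) :=
  Finset.univ.image (orbitOf f)

/-- `ec č`: the number of even cycles of the completion of a reduced contributor. -/
def ecR (G : OHG V E I) (U : Finset V) (φ : {v : V // v ∈ U} ↪ V)
    (c : {v : V // v ∉ U} → I × I) : ℕ :=
  ((orbitsOf (compFun G U φ c)).filter fun O => Even O.card).card

/-- `bs c`: the number of backsteps of a reduced contributor. -/
def bsR (U : Finset V) (c : {v : V // v ∉ U} → I × I) : ℕ :=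
  (Finset.univ.filter fun v : {v : V // v ∉ U} => (c v).1 = (c v).2).card

/-- The arc relation of the digraph on `V` with an arc `v → ς (h_v)` for each
`v ∈ V∖U`. -/
def arcRel (G : OHG V E I) (U : Finset V) (c : {v : V // v ∉ U} → I × I) :
    V → V → Prop :=
  fun a b => ∃ v : {v : V // v ∉ U}, v.1 = a ∧ G.vtx (c v).2 = b

/-- The connected component of `v` in the digraph of a reduced contributor. -/
def compOf (G : OHG V E I) (U : Finset V) (c : {v : V // v ∉ U} → I × I) (v : V) :
    Finset V :=
  Finset.univ.filter fun w => Relation.EqvGen (arcRel G U c) v w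

/-- The components of a reduced contributor. -/
def compsOf (G : OHG V E I) (U : Finset V) (c : {v : V // v ∉ U} → I × I) :
    Finset (Finset V) :=
  Finset.univ.image (compOf G U c)

/-- A negative component: not a single backstep, and the product of the adjacency
signs `-σ(t_v)·σ(h_v)` over the arcs it contains is `-1`. -/
def NegComp (G : OHG V E I) (U : Finset V) (c : {v : V // v ∉ U} → I × I)
    (O : Finset V) : Prop :=
  (¬ ∃ v : {v : V // v ∉ U}, O = {v.1} ∧ (c v).1 = (c v).2) ∧
    ∏ v ∈ Finset.univ.filter (fun v : {v : V // v ∉ U} => v.1 ∈ O),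
      (-(G.sgn (c v).1 * G.sgn (c v).2)) = (-1 : ℤˣ)

/-- `nc c`: the number of negative components of a reduced contributor. -/
def ncR (G : OHG V E I) (U : Finset V) (c : {v : V // v ∉ U} → I × I) : ℕ :=
  ((compsOf G U c).filter (NegComp G U c)).card

/-- The sign `csgn c = (-1) ^ (ec č + nc c + bs c)` of a reduced contributor. -/
def csgnR (G : OHG V E I) (U : Finset V) (φ : {v : V // v ∈ U} ↪ V)
    (c : {v : V // v ∉ U} → I × I) : ℤ :=
  (-1) ^ (ecR G U φ c + ncR G U c + bsR U c)

/-- A reduced contributor is edge-monic when its tail edges are pairwise distinct. -/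
def EdgeMonicR (G : OHG V E I) (U : Finset V) (c : {v : V // v ∉ U} → I × I) : Prop :=
  Function.Injective fun v : {v : V // v ∉ U} => G.edg (c v).1

/-- The incidence matrix of an oriented hypergraph. -/
def incM (G : OHG V E I) : Matrix V E ℤ :=
  Matrix.of fun v e =>
    ∑ i ∈ Finset.univ.filter (fun i => G.vtx i = v ∧ G.edg i = e), (G.sgn i : ℤ)

/-- The Laplacian `L = H Hᵀ` of an oriented hypergraph. -/
def lapM (G : OHG V E I) : Matrix V V ℤ :=
  incM G * (incM G)ᵀ

set_option linter.unusedSectionVars false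

theorem IsRedCont.compFun_bijective {G : OHG V E I} {U : Finset V} {φ : {v : V // v ∈ U} ↪ V}
    {c : {v : V // v ∉ U} → I × I} (hc : IsRedCont G U φ c) :
    Function.Bijective (compFun G U φ c) := by
  rw [← Finite.injective_iff_bijective]
  obtain ⟨-, -, hmaps, hinj, -⟩ := hc
  intro a b hab
  unfold compFun at hab
  split_ifs at hab with ha hb hb
  · simpa using φ.injective hab
  · exact absurd ⟨_, hab⟩ (hmaps (Set.mem_univ ⟨b, hb⟩))
  · exact absurd ⟨_, hab.symm⟩ (hmaps (Set.mem_univ ⟨a, ha⟩))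
  · simpa using hinj (Set.mem_univ ⟨a, ha⟩) (Set.mem_univ ⟨b, hb⟩) hab

/-- The completion of a reduced contributor as a permutation. -/
def IsRedCont.compPerm {G : OHG V E I} {U : Finset V} {φ : {v : V // v ∈ U} ↪ V}
    {c : {v : V // v ∉ U} → I × I} (hc : IsRedCont G U φ c) : Equiv.Perm V :=
  Equiv.ofBijective _ hc.compFun_bijective

theorem mem_orbitOf_perm (π : Equiv.Perm V) (v w : V) : w ∈ orbitOf π v ↔ π.SameCycle v w := by
  simp only [orbitOf, Finset.mem_filter, Finset.mem_univ, true_and, ← Equiv.Perm.coe_pow]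
  refine ⟨fun ⟨n, hn⟩ => ⟨n, by simpa using hn⟩, fun h => ?_⟩
  obtain ⟨n, -, -, hn⟩ := h.exists_pow_eq''
  exact ⟨n, hn⟩

theorem orbitOf_perm_of_ne {π : Equiv.Perm V} {v : V} (h : π v ≠ v) :
    orbitOf π v = (π.cycleOf v).support := by
  ext w
  rw [mem_orbitOf_perm, Equiv.Perm.mem_support_cycleOf_iff' h]

theorem orbitOf_perm_of_eq {π : Equiv.Perm V} {v : V} (h : π v = v) : orbitOf π v = {v} := by
  ext w
  rw [mem_orbitOf_perm, Finset.mem_singleton]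
  refine ⟨fun hw => ?_, fun hw => hw ▸ Equiv.Perm.SameCycle.refl _ _⟩
  exact (hw.eq_of_left h).symm

/-- The sign of a permutation counts its even cycles. -/
theorem sign_eq_neg_one_pow_card_even_orbitsOf (π : Equiv.Perm V) :
    Equiv.Perm.sign π = (-1) ^ ((orbitsOf π).filter fun O => Even O.card).card := by
  have hsign : Equiv.Perm.sign π
      = ∏ g ∈ π.cycleFactorsFinset, if Even g.support.card then (-1 : ℤˣ) else 1 := by
    conv_lhs => rw [← π.cycleFactorsFinset_noncommProd]
    rw [Finset.map_noncommProd, Finset.noncommProd_eq_prod]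
    refine Finset.prod_congr rfl fun g hg => ?_
    rw [id, (Equiv.Perm.mem_cycleFactorsFinset_iff.mp hg).1.sign]
    split_ifs with he
    · rw [he.neg_one_pow]
    · rw [(Nat.not_even_iff_odd.mp he).neg_one_pow, neg_neg]
  rw [hsign, Finset.prod_ite, Finset.prod_const_one, mul_one, Finset.prod_const]
  congr 1
  refine Finset.card_bij (fun g _ => g.support) ?_ ?_ ?_
  · intro g hg
    rw [Finset.mem_filter] at hg ⊢
    refine ⟨?_, hg.2⟩
    obtain ⟨x, hx⟩ := (Equiv.Perm.mem_cycleFactorsFinset_iff.mp hg.1).1.nonempty_support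
    have hgx := Equiv.Perm.cycle_is_cycleOf hx hg.1
    have hπx : π x ≠ x :=
      Equiv.Perm.mem_support.mp (Equiv.Perm.mem_cycleFactorsFinset_support_le hg.1 hx)
    exact Finset.mem_image.mpr ⟨x, Finset.mem_univ _, by rw [orbitOf_perm_of_ne hπx, hgx]⟩
  · intro g hg g' hg' hgg
    rw [Finset.mem_filter] at hg hg'
    obtain ⟨x, hx⟩ := (Equiv.Perm.mem_cycleFactorsFinset_iff.mp hg.1).1.nonempty_support
    rw [Equiv.Perm.cycle_is_cycleOf hx hg.1, Equiv.Perm.cycle_is_cycleOf (hgg ▸ hx) hg'.1]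
  · intro O hO
    rw [Finset.mem_filter, orbitsOf, Finset.mem_image] at hO
    obtain ⟨⟨x, -, rfl⟩, he⟩ := hO
    by_cases hπx : π x = x
    · rw [orbitOf_perm_of_eq hπx] at he
      simp at he
    · rw [orbitOf_perm_of_ne hπx] at he ⊢
      exact ⟨_, Finset.mem_filter.mpr ⟨Equiv.Perm.cycleOf_mem_cycleFactorsFinset_iff.mpr
        (Equiv.Perm.mem_support.mpr hπx), he⟩, rfl⟩

theorem IsRedCont.neg_one_pow_ecR {G : OHG V E I} {U : Finset V} {φ : {v : V // v ∈ U} ↪ V}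
    {c : {v : V // v ∉ U} → I × I} (hc : IsRedCont G U φ c) :
    (-1 : ℤˣ) ^ ecR G U φ c = Equiv.Perm.sign hc.compPerm :=
  (sign_eq_neg_one_pow_card_even_orbitsOf hc.compPerm).symm

theorem mem_compOf (G : OHG V E I) (U : Finset V) (c : {v : V // v ∉ U} → I × I) (v w : V) :
    w ∈ compOf G U c v ↔ Relation.EqvGen (arcRel G U c) v w := by
  simp [compOf]

theorem compOf_eq_iff (G : OHG V E I) (U : Finset V) (c : {v : V // v ∉ U} → I × I) (v w : V) :
    compOf G U c w = compOf G U c v ↔ w ∈ compOf G U c v := by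
  constructor
  · intro h
    rw [← h, mem_compOf]
    exact .refl _
  · intro h
    rw [mem_compOf] at h
    ext x
    simp only [mem_compOf]
    exact ⟨fun hx => .trans _ _ _ h hx, fun hx => .trans _ _ _ (.symm _ _ h) hx⟩

/-- The component of a backstep is a single vertex. -/
theorem IsRedCont.compOf_of_backstep {G : OHG V E I} {U : Finset V}
    {φ : {v : V // v ∈ U} ↪ V} {c : {v : V // v ∉ U} → I × I} (hc : IsRedCont G U φ c)
    {v : {v : V // v ∉ U}} (hv : (c v).1 = (c v).2) : compOf G U c v = {v.1} := by
  have hloop : G.vtx (c v).2 = v.1 := hv ▸ hc.1 v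
  have key : ∀ a b, Relation.EqvGen (arcRel G U c) a b → (a = v.1 ↔ b = v.1) := by
    intro a b hab
    induction hab with
    | rel a b h =>
      obtain ⟨u, rfl, rfl⟩ := h
      constructor
      · intro h
        rw [Subtype.ext h, hloop]
      · intro h
        exact congrArg Subtype.val
          (hc.2.2.injOn (Set.mem_univ u) (Set.mem_univ v) (h.trans hloop.symm))
    | refl => rfl
    | symm _ _ _ ih => exact ih.symm
    | trans _ _ _ _ _ ih₁ ih₂ => exact ih₁.trans ih₂
  ext w
  rw [mem_compOf, Finset.mem_singleton]
  exact ⟨fun h => (key _ _ h).mp rfl, fun h => h ▸ .refl _⟩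

/-- The product of all adjacency signs of a reduced contributor counts its negative components
and its backsteps. -/
theorem IsRedCont.prod_adjacency_signs {G : OHG V E I} {U : Finset V}
    {φ : {v : V // v ∈ U} ↪ V} {c : {v : V // v ∉ U} → I × I} (hc : IsRedCont G U φ c) :
    ∏ v, (-(G.sgn (c v).1 * G.sgn (c v).2)) = (-1) ^ (ncR G U c + bsR U c) := by
  have hmem : ∀ v ∈ (Finset.univ : Finset {v : V // v ∉ U}), compOf G U c v ∈ compsOf G U c :=
    fun v _ => Finset.mem_image_of_mem _ (Finset.mem_univ _)
  rw [← Finset.prod_fiberwise_of_maps_to hmem]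
  have hterm : ∀ O ∈ compsOf G U c,
      ∏ v ∈ Finset.univ.filter (fun v : {v : V // v ∉ U} => compOf G U c v = O),
        (-(G.sgn (c v).1 * G.sgn (c v).2))
      = (if NegComp G U c O then -1 else 1) *
        (if ∃ v : {v : V // v ∉ U}, O = {v.1} ∧ (c v).1 = (c v).2 then -1 else 1) := by
    intro O hO
    have hfilter : Finset.univ.filter (fun v : {v : V // v ∉ U} => compOf G U c v = O)
        = Finset.univ.filter (fun v : {v : V // v ∉ U} => v.1 ∈ O) := by
      obtain ⟨x, -, rfl⟩ := Finset.mem_image.mp hO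
      simp only [compOf_eq_iff]
    rw [hfilter]
    by_cases hb : ∃ v : {v : V // v ∉ U}, O = {v.1} ∧ (c v).1 = (c v).2
    · rw [if_neg fun h : NegComp G U c O => h.1 hb, if_pos hb]
      obtain ⟨v, rfl, hv⟩ := hb
      have : Finset.univ.filter (fun w : {v : V // v ∉ U} => w.1 ∈ ({v.1} : Finset V)) = {v} := by
        ext w
        simp [Subtype.ext_iff]
      rw [this, Finset.prod_singleton, hv, Int.units_mul_self, one_mul]
    · rw [if_neg hb, mul_one]
      split_ifs with hn
      · exact hn.2
      · exact (Int.units_eq_one_or _).resolve_right fun h => hn ⟨hb, h⟩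
  rw [Finset.prod_congr rfl hterm, Finset.prod_mul_distrib, Finset.prod_ite, Finset.prod_ite,
    Finset.prod_const_one, Finset.prod_const_one, mul_one, mul_one, Finset.prod_const,
    Finset.prod_const, pow_add]
  congr 2
  refine (Finset.card_bij (fun v _ => {v.1}) ?_ ?_ ?_).symm
  · intro v hv
    rw [Finset.mem_filter] at hv ⊢
    exact ⟨hc.compOf_of_backstep hv.2 ▸ hmem v (Finset.mem_univ _), v, rfl, hv.2⟩
  · intro v _ w _ h
    exact Subtype.ext (Finset.singleton_injective h)
  · intro O hO
    obtain ⟨-, v, rfl, hv⟩ := Finset.mem_filter.mp hO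
    exact ⟨v, Finset.mem_filter.mpr ⟨Finset.mem_univ _, hv⟩, rfl⟩

theorem IsRedCont.csgnR_eq {G : OHG V E I} {U : Finset V} {φ : {v : V // v ∈ U} ↪ V}
    {c : {v : V // v ∉ U} → I × I} (hc : IsRedCont G U φ c) :
    csgnR G U φ c = ((Equiv.Perm.sign hc.compPerm *
      ∏ v, (-(G.sgn (c v).1 * G.sgn (c v).2)) : ℤˣ) : ℤ) := by
  rw [hc.prod_adjacency_signs, ← hc.neg_one_pow_ecR, ← pow_add, ← add_assoc]
  simp [csgnR]

/-- Exchange the heads of two arcs. -/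
def swapHeads {U : Finset V} (c : {v : V // v ∉ U} → I × I) (a b : {v : V // v ∉ U}) :
    {v : V // v ∉ U} → I × I :=
  fun v => ((c v).1, (c (Equiv.swap a b v)).2)

theorem swapHeads_swapHeads {U : Finset V} (c : {v : V // v ∉ U} → I × I)
    (a b : {v : V // v ∉ U}) : swapHeads (swapHeads c a b) a b = c := by
  funext v
  simp [swapHeads]

theorem IsRedCont.swapHeads {G : OHG V E I} {U : Finset V} {φ : {v : V // v ∈ U} ↪ V}
    {c : {v : V // v ∉ U} → I × I} (hc : IsRedCont G U φ c) {a b : {v : V // v ∉ U}}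
    (hab : G.edg (c a).1 = G.edg (c b).1) : IsRedCont G U φ (swapHeads c a b) := by
  refine ⟨hc.1, fun v => ?_, ?_⟩
  · simp only [_root_.swapHeads, ← hc.2.1]
    rcases eq_or_ne v a with rfl | hva
    · rw [Equiv.swap_apply_left, hab]
    rcases eq_or_ne v b with rfl | hvb
    · rw [Equiv.swap_apply_right, hab]
    · rw [Equiv.swap_apply_of_ne_of_ne hva hvb]
  · exact hc.2.2.comp (Set.bijOn_univ.mpr (Equiv.swap a b).bijective)

theorem IsRedCont.compPerm_swapHeads {G : OHG V E I} {U : Finset V} {φ : {v : V // v ∈ U} ↪ V}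
    {c : {v : V // v ∉ U} → I × I} (hc : IsRedCont G U φ c) {a b : {v : V // v ∉ U}}
    (hc' : IsRedCont G U φ (_root_.swapHeads c a b)) :
    hc'.compPerm = hc.compPerm * Equiv.swap a.1 b.1 := by
  ext v
  change compFun G U φ _ v = compFun G U φ c (Equiv.swap a.1 b.1 v)
  by_cases hv : v ∈ U
  · have hva : v ≠ a.1 := fun h => a.2 (h ▸ hv)
    have hvb : v ≠ b.1 := fun h => b.2 (h ▸ hv)
    rw [Equiv.swap_apply_of_ne_of_ne hva hvb]
    simp [compFun, hv]
  · have hval : Equiv.swap a.1 b.1 v = (Equiv.swap a b ⟨v, hv⟩).1 := by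
      simp only [Equiv.swap_apply_def, Subtype.ext_iff]
      split_ifs <;> rfl
    rw [hval]
    simp [compFun, hv, _root_.swapHeads, (Equiv.swap a b ⟨v, hv⟩).2]

theorem IsRedCont.csgnR_add_csgnR_swapHeads {G : OHG V E I} {U : Finset V}
    {φ : {v : V // v ∈ U} ↪ V} {c : {v : V // v ∉ U} → I × I} (hc : IsRedCont G U φ c)
    {a b : {v : V // v ∉ U}} (hne : a ≠ b) (hab : G.edg (c a).1 = G.edg (c b).1) :
    csgnR G U φ c + csgnR G U φ (_root_.swapHeads c a b) = 0 := by
  have hprod : ∀ d : {v : V // v ∉ U} → I × I, ∏ v, (-(G.sgn (d v).1 * G.sgn (d v).2))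
      = (∏ v, -G.sgn (d v).1) * ∏ v, G.sgn (d v).2 := by
    intro d
    rw [← Finset.prod_mul_distrib]
    exact Finset.prod_congr rfl fun v _ => (neg_mul _ _).symm
  have hheads : ∏ v, G.sgn (_root_.swapHeads c a b v).2 = ∏ v, G.sgn (c v).2 :=
    Equiv.prod_comp (Equiv.swap a b) fun v => G.sgn (c v).2
  have htails : ∏ v, -G.sgn (_root_.swapHeads c a b v).1 = ∏ v, -G.sgn (c v).1 := rfl
  rw [hc.csgnR_eq, (hc.swapHeads hab).csgnR_eq, hc.compPerm_swapHeads, Equiv.Perm.sign_mul,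
    Equiv.Perm.sign_swap (fun h => hne (Subtype.ext h)), hprod, hprod, hheads, htails]
  push_cast
  ring

/-- Contributors that are not edge-monic cancel in pairs. -/
theorem sum_csgnR_edgeMonic (G : OHG V E I) (U : Finset V) (φ : {v : V // v ∈ U} ↪ V) :
    ∑ c ∈ Finset.univ.filter
        (fun c : {v : V // v ∉ U} → I × I => IsRedCont G U φ c ∧ EdgeMonicR G U c),
      csgnR G U φ c
    = ∑ c ∈ Finset.univ.filter
        (fun c : {v : V // v ∉ U} → I × I => IsRedCont G U φ c), csgnR G U φ c := by
  have hpair : ∀ f : {f : {v : V // v ∉ U} → E // ¬ Function.Injective f},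
      ∃ p : {v : V // v ∉ U} × {v : V // v ∉ U}, f.1 p.1 = f.1 p.2 ∧ p.1 ≠ p.2 := by
    rintro ⟨f, hf⟩
    obtain ⟨a, b, h⟩ := Function.not_injective_iff.mp hf
    exact ⟨(a, b), h⟩
  choose p hp hpne using hpair
  rw [← Finset.sum_filter_add_sum_filter_not
      (Finset.univ.filter fun c : {v : V // v ∉ U} → I × I => IsRedCont G U φ c) (EdgeMonicR G U),
    Finset.filter_filter, left_eq_add]
  have hmem : ∀ c ∈ (Finset.univ.filter fun c : {v : V // v ∉ U} → I × I =>
      IsRedCont G U φ c).filter (fun c => ¬ EdgeMonicR G U c),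
      IsRedCont G U φ c ∧ ¬ EdgeMonicR G U c := by
    intro c hc
    simpa using hc
  refine Finset.sum_involution
    (fun c hc => swapHeads c (p ⟨_, (hmem c hc).2⟩).1 (p ⟨_, (hmem c hc).2⟩).2) ?_ ?_ ?_ ?_
  · intro c hc
    exact (hmem c hc).1.csgnR_add_csgnR_swapHeads (hpne _) (hp ⟨_, (hmem c hc).2⟩)
  · intro c hc _ heq
    refine hpne ⟨_, (hmem c hc).2⟩ ?_
    have h := congrArg (fun d => G.vtx (d (p ⟨_, (hmem c hc).2⟩).1).2) heq
    simp only [swapHeads, Equiv.swap_apply_left] at h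
    exact ((hmem c hc).1.2.2.injOn (Set.mem_univ _) (Set.mem_univ _) h).symm
  · intro c hc
    simp only [Finset.mem_filter, Finset.mem_univ, true_and]
    exact ⟨(hmem c hc).1.swapHeads (hp ⟨_, (hmem c hc).2⟩), (hmem c hc).2⟩
  · intro c hc
    exact swapHeads_swapHeads _ _ _

theorem lapM_apply (G : OHG V E I) (v w : V) :
    lapM G v w = ∑ p : I × I,
      if G.vtx p.1 = v ∧ G.edg p.1 = G.edg p.2 ∧ G.vtx p.2 = w then
        (G.sgn p.1 : ℤ) * G.sgn p.2 else 0 := by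
  simp only [lapM, incM, Matrix.mul_apply, Matrix.transpose_apply, Matrix.of_apply,
    Finset.sum_filter, Finset.sum_mul_sum, Fintype.sum_prod_type]
  rw [Finset.sum_comm]
  refine Finset.sum_congr rfl fun i _ => ?_
  rw [Finset.sum_comm]
  refine Finset.sum_congr rfl fun j _ => ?_
  rw [Finset.sum_eq_single (G.edg i)]
  · by_cases h₁ : G.vtx i = v <;> by_cases h₂ : G.vtx j = w <;>
      by_cases h₃ : G.edg i = G.edg j <;> simp [h₁, h₂, h₃, eq_comm]
  · intro e _ he
    simp [he.symm]
  · simp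

/-- `π` agrees with the head map of `c`, whose tails sit at their vertices and share edges with
their heads. -/
def FollowsArcs (G : OHG V E I) (U : Finset V) (c : {v : V // v ∉ U} → I × I)
    (π : Equiv.Perm V) : Prop :=
  ∀ v, G.vtx (c v).1 = v.1 ∧ G.edg (c v).1 = G.edg (c v).2 ∧ G.vtx (c v).2 = π v.1

theorem prod_neg_lapM (G : OHG V E I) (U : Finset V) (π : Equiv.Perm V) :
    ∏ v : {v : V // v ∉ U}, -lapM G v.1 (π v.1)
    = ∑ c : {v : V // v ∉ U} → I × I, if FollowsArcs G U c π then
        ((∏ v, (-(G.sgn (c v).1 * G.sgn (c v).2)) : ℤˣ) : ℤ) else 0 := by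
  simp only [lapM_apply, ← Finset.sum_neg_distrib]
  rw [Finset.prod_univ_sum, Fintype.piFinset_univ]
  refine Finset.sum_congr rfl fun c _ => ?_
  split_ifs with h
  · rw [Units.coe_prod]
    refine Finset.prod_congr rfl fun v _ => ?_
    rw [if_pos (h v)]
    simp
  · obtain ⟨v, hv⟩ := not_forall.mp h
    exact Finset.prod_eq_zero (Finset.mem_univ v) (by rw [if_neg hv, neg_zero])

theorem FollowsArcs.isRedCont {G : OHG V E I} {U : Finset V} {c : {v : V // v ∉ U} → I × I}
    {π : Equiv.Perm V} (h : FollowsArcs G U c π) :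
    IsRedCont G U ((Function.Embedding.subtype _).trans π.toEmbedding) c := by
  refine ⟨fun v => (h v).1, fun v => (h v).2.1, fun v _ => ?_, fun v _ w _ hvw => ?_, fun w hw => ?_⟩
  · rintro ⟨u, hu⟩
    have huv : u.1 = v.1 := π.injective (hu.trans (h v).2.2)
    exact v.2 (huv ▸ u.2)
  · simp only [(h _).2.2] at hvw
    exact Subtype.ext (π.injective hvw)
  · have hU : π.symm w ∉ U := fun hU => hw ⟨⟨_, hU⟩, π.apply_symm_apply w⟩
    exact ⟨⟨_, hU⟩, Set.mem_univ _, by simp [(h _).2.2]⟩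

theorem IsRedCont.followsArcs {G : OHG V E I} {U : Finset V} {φ : {v : V // v ∈ U} ↪ V}
    {c : {v : V // v ∉ U} → I × I} (hc : IsRedCont G U φ c) : FollowsArcs G U c hc.compPerm :=
  fun v => ⟨hc.1 v, hc.2.1 v, by simp [IsRedCont.compPerm, compFun, v.2]⟩

theorem IsRedCont.compPerm_apply_mem {G : OHG V E I} {U : Finset V} {φ : {v : V // v ∈ U} ↪ V}
    {c : {v : V // v ∉ U} → I × I} (hc : IsRedCont G U φ c) (u : {v : V // v ∈ U}) :
    hc.compPerm u = φ u := by
  simp [IsRedCont.compPerm, compFun]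

theorem FollowsArcs.compPerm_eq {G : OHG V E I} {U : Finset V} {c : {v : V // v ∉ U} → I × I}
    {π : Equiv.Perm V} (h : FollowsArcs G U c π) : h.isRedCont.compPerm = π := by
  ext v
  by_cases hv : v ∈ U
  · exact h.isRedCont.compPerm_apply_mem ⟨v, hv⟩
  · rw [← (h.isRedCont.followsArcs ⟨v, hv⟩).2.2, (h ⟨v, hv⟩).2.2]

/-- Permutations following the arcs of `c` correspond to injections making `c` a reduced
contributor. -/
theorem sum_followsArcs (G : OHG V E I) (U : Finset V) (c : {v : V // v ∉ U} → I × I) :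
    ∑ π ∈ Finset.univ.filter (FollowsArcs G U c),
      MvPolynomial.C (((Equiv.Perm.sign π * ∏ v, (-(G.sgn (c v).1 * G.sgn (c v).2)) : ℤˣ)) : ℤ) *
        ∏ u : {v : V // v ∈ U}, (MvPolynomial.X (u.1, π u.1) : MvPolynomial (V × V) ℤ)
    = ∑ φ ∈ Finset.univ.filter (fun φ : {v : V // v ∈ U} ↪ V => IsRedCont G U φ c),
      MvPolynomial.C (csgnR G U φ c) * ∏ u : {v : V // v ∈ U}, MvPolynomial.X (u.1, φ u) := by
  refine Finset.sum_bij' (fun π _ => (Function.Embedding.subtype _).trans π.toEmbedding)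
    (fun φ hφ => (Finset.mem_filter.mp hφ).2.compPerm) ?_ ?_ ?_ ?_ ?_
  · intro π hπ
    exact Finset.mem_filter.mpr ⟨Finset.mem_univ _, (Finset.mem_filter.mp hπ).2.isRedCont⟩
  · intro φ hφ
    exact Finset.mem_filter.mpr ⟨Finset.mem_univ _, (Finset.mem_filter.mp hφ).2.followsArcs⟩
  · intro π hπ
    exact (Finset.mem_filter.mp hπ).2.compPerm_eq
  · intro φ hφ
    ext u
    exact (Finset.mem_filter.mp hφ).2.compPerm_apply_mem u
  · intro π hπ
    have h := (Finset.mem_filter.mp hπ).2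
    rw [h.isRedCont.csgnR_eq, h.compPerm_eq]
    rfl

/-- **Total-minor Polynomial v2.** For an oriented hypergraph `G` with
Laplacian `L = H Hᵀ` and matrix of indeterminates `X = (x_{v,w})`,
`det (X - L) = Σ_{(U,φ)} (Σ_c csgn c) Π_{u ∈ U} x_{u, φ u}`, where `(U, φ)` ranges over
all subsets `U ⊆ V` with an injection `φ : U → V`, and `c` ranges over only the
edge-monic nonzero reduced `[u,w]`-contributors of `G` for `φ`. -/
theorem total_minor_polynomial_v2 (G : OHG V E I) :
    Matrix.det
        ((Matrix.of fun v w : V => (MvPolynomial.X (v, w) : MvPolynomial (V × V) ℤ)) -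
          (lapM G).map fun n : ℤ => (n : MvPolynomial (V × V) ℤ))
      = ∑ U : Finset V, ∑ φ : {v : V // v ∈ U} ↪ V,
          MvPolynomial.C
              (∑ c ∈ Finset.univ.filter
                  (fun c : {v : V // v ∉ U} → I × I =>
                    IsRedCont G U φ c ∧ EdgeMonicR G U c),
                csgnR G U φ c) *
            ∏ u : {v : V // v ∈ U}, MvPolynomial.X (u.1, φ u) := by
  simp only [sum_csgnR_edgeMonic]
  have hL : ∀ (U : Finset V) (π : Equiv.Perm V),
      ∏ v ∈ Finset.univ \ U, -((lapM G v (π v) : ℤ) : MvPolynomial (V × V) ℤ)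
      = ∑ c : {v : V // v ∉ U} → I × I, if FollowsArcs G U c π then
          MvPolynomial.C ((∏ v, (-(G.sgn (c v).1 * G.sgn (c v).2)) : ℤˣ) : ℤ) else 0 := by
    intro U π
    have h := congrArg (MvPolynomial.C (σ := V × V)) (prod_neg_lapM G U π)
    rw [map_prod, map_sum] at h
    simp only [apply_ite (MvPolynomial.C (σ := V × V)), map_zero] at h
    rw [← h, Finset.prod_subtype (F := inferInstance) (p := fun v => v ∉ U) _ (fun v => by simp)]
    simp
  rw [← Matrix.det_transpose, Matrix.det_apply']
  simp only [Matrix.transpose_apply, Matrix.sub_apply, Matrix.of_apply, Matrix.map_apply]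
  simp only [sub_eq_add_neg, Finset.prod_add, Finset.powerset_univ, hL, Finset.mul_sum]
  rw [Finset.sum_comm]
  refine Finset.sum_congr rfl fun U _ => ?_
  simp only [map_sum, Finset.sum_mul, Finset.sum_filter]
  refine Finset.sum_comm.trans ((Finset.sum_congr rfl fun c _ => ?_).trans Finset.sum_comm)
  have h := sum_followsArcs G U c
  rw [Finset.sum_filter, Finset.sum_filter] at h
  convert h using 2 with π _ φ _
  · rw [mul_ite, mul_ite, mul_zero, mul_zero, Finset.prod_subtype (p := fun v => v ∈ U) U
      fun v => Iff.rfl]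
    refine if_congr Iff.rfl ?_ rfl
    rw [Units.val_mul, map_mul, mul_comm (∏ u, _), ← mul_assoc]
    simp
  · split_ifs <;> simp
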